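/- (Conjugation move M3) Let w be a braid word on n strands, let i ∈ {1, …, n−1} and ε ∈ {+1, −1}, and consider the two braid words (i,ε)·w (the letter prepended to w) and w·(i,ε) (the letter appended to w), which represent conjugate braids. Then there exists a unimodular integer matrix P (det P = ±1) such that M((i,ε)·w) = Pᵀ · M(w·(i,ε)) · P; that is, the linking matrices of the two words are unimodular-congruent. -/

import Mathlib

open Matrix

/-- A letter of a braid word: a pair (column, sign). -/
abbrev Letter : Type := ℕ × ℤ

/-- A cycle on the laundry surface: `Sum.inl i` is the circle cycle `C_i` (1-indexed),
`Sum.inr k` is the band cycle `X_{k+1}` (i.e. the band of the letter in position `k`,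
0-indexed). -/
abbrev Cyc : Type := ℕ ⊕ ℕ

/-- `w` is a braid word on `n` strands: `n ≥ 2`, `w` nonempty, and each letter `(c, ε)`
has column `1 ≤ c ≤ n - 1` and sign `ε = ±1`. -/
def IsBraidWord (n : ℕ) (w : List Letter) : Prop :=
  2 ≤ n ∧ w ≠ [] ∧ ∀ ℓ ∈ w, 1 ≤ ℓ.1 ∧ ℓ.1 ≤ n - 1 ∧ (ℓ.2 = 1 ∨ ℓ.2 = -1)

/-- A single B0 move: swap two adjacent letters whose columns differ by more than 1. -/
inductive B0Step : List Letter → List Letter → Prop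
  | swap (u v : List Letter) (a b : Letter)
      (h : 1 < (a.1 : ℤ) - (b.1 : ℤ) ∨ 1 < (b.1 : ℤ) - (a.1 : ℤ)) :
      B0Step (u ++ a :: b :: v) (u ++ b :: a :: v)

/-- B0-equivalence: a finite sequence of B0 moves. -/
def B0Equiv : List Letter → List Letter → Prop := Relation.ReflTransGen B0Step

/-- The column of the `k`-th letter (0-indexed) of `w`. -/
def colOf (w : List Letter) (k : ℕ) : ℕ := (w.getD k (0, 0)).1

/-- The sign of the `k`-th letter (0-indexed) of `w`. -/
def signOf (w : List Letter) (k : ℕ) : ℤ := (w.getD k (0, 0)).2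

/-- The band cycles `X_k` with column `c_k ∈ {e - 1, e}`, in decreasing order of `k`. -/
def bandBlock (w : List Letter) (e : ℕ) : List Cyc :=
  ((List.range w.length).reverse.filter fun k => colOf w k == e - 1 || colOf w k == e).map
    Sum.inr

/-- The cycles of `w` in laundry order: for each even `e = 2, 4, …, ≤ n` in increasing
order, the circle `C_e` followed by all bands `X_k` with `c_k ∈ {e-1, e}` in decreasing
order of `k`; then the circles `C_i` for odd `i ≤ n` in decreasing order of `i`. -/
def laundryList (n : ℕ) (w : List Letter) : List Cyc :=
  (((List.range (n + 1)).filter fun e => e % 2 == 0 && e != 0).flatMap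
      fun e => Sum.inl e :: bandBlock w e) ++
    ((List.range (n + 1)).filter fun i => i % 2 == 1).reverse.map Sum.inl

/-- The linking number of (the double push-off of) one cycle of `w` with another. -/
def entry (w : List Letter) : Cyc → Cyc → ℤ
  | Sum.inl _, Sum.inl _ => 0
  | Sum.inr k, Sum.inr l =>
      if k = l then signOf w k
      else if (colOf w l = colOf w k + 1 ∧ k < l) ∨ (colOf w l + 1 = colOf w k ∧ l < k) then 1
      else 0
  | Sum.inr k, Sum.inl j =>
      if j = colOf w k then -1 else if j = colOf w k + 1 then 1 else 0
  | Sum.inl j, Sum.inr k =>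
      if j = colOf w k then -1 else if j = colOf w k + 1 then 1 else 0

/-- The linking matrix `M(w)` of a braid word `w` with `m` letters on `n` strands:
the `(n+m) × (n+m)` integer matrix of linking numbers, rows and columns indexed by the
cycles of `w` in laundry order. -/
def linkMat (n m : ℕ) (w : List Letter) : Matrix (Fin (n + m)) (Fin (n + m)) ℤ :=
  fun p q =>
    entry w ((laundryList n w).getD p (Sum.inl 0)) ((laundryList n w).getD q (Sum.inl 0))

/-- A letter of a braid word on `n` strands. -/
def IsBraidLetter (n : ℕ) (l : Letter) : Prop := 1 ≤ l.1 ∧ l.1 ≤ n - 1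

theorem mem_bandBlock {w : List Letter} {e : ℕ} {x : Cyc} :
    x ∈ bandBlock w e ↔
      ∃ k < w.length, (colOf w k = e - 1 ∨ colOf w k = e) ∧ x = Sum.inr k := by
  simp only [bandBlock, List.mem_map, List.mem_filter, List.mem_reverse, List.mem_range,
    Bool.or_eq_true, beq_iff_eq]
  constructor
  · rintro ⟨k, ⟨hk, hc⟩, rfl⟩
    exact ⟨k, hk, hc, rfl⟩
  · rintro ⟨k, hk, hc, rfl⟩
    exact ⟨k, ⟨hk, hc⟩, rfl⟩

theorem nodup_bandBlock (w : List Letter) (e : ℕ) : (bandBlock w e).Nodup :=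
  ((List.nodup_reverse.2 List.nodup_range).filter _).map Sum.inr_injective

theorem nodup_laundryList (n : ℕ) (w : List Letter) : (laundryList n w).Nodup := by
  have hnodup : (List.range (n + 1)).Nodup := List.nodup_range
  rw [laundryList, List.nodup_append']
  refine ⟨List.nodup_flatMap.2 ⟨fun e _ => ?_, ?_⟩, ?_, ?_⟩
  · refine List.nodup_cons.2 ⟨fun h => ?_, nodup_bandBlock w e⟩
    obtain ⟨k, -, -, h⟩ := mem_bandBlock.1 h
    cases h
  · refine List.Nodup.pairwise_of_forall_ne (hnodup.filter _) fun a ha b hb hab => ?_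
    simp only [List.mem_filter, List.mem_range, Bool.and_eq_true, beq_iff_eq, bne_iff_ne] at ha hb
    intro x hxa hxb
    rw [List.mem_cons, mem_bandBlock] at hxa hxb
    rcases hxa with rfl | ⟨k, -, hk, rfl⟩ <;> rcases hxb with hx | ⟨l, -, hl, hx⟩ <;> cases hx
    · exact hab rfl
    · omega
  · exact (List.nodup_reverse.2 (hnodup.filter _)).map Sum.inl_injective
  · intro x hx hx'
    simp only [List.mem_flatMap, List.mem_map, List.mem_reverse, List.mem_filter, List.mem_range,
      Bool.and_eq_true, beq_iff_eq, bne_iff_ne, List.mem_cons, mem_bandBlock] at hx hx'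
    obtain ⟨j, hj, rfl⟩ := hx'
    obtain ⟨e, he, hx | ⟨k, -, -, hx⟩⟩ := hx <;> cases hx
    omega

theorem inl_mem_laundryList {n j : ℕ} {w : List Letter} :
    Sum.inl j ∈ laundryList n w ↔ 1 ≤ j ∧ j ≤ n := by
  simp only [laundryList, List.mem_append, List.mem_flatMap, List.mem_map, List.mem_reverse,
    List.mem_filter, List.mem_range, Bool.and_eq_true, beq_iff_eq, bne_iff_ne, List.mem_cons,
    mem_bandBlock, Sum.inl.injEq, reduceCtorEq, and_false, exists_false, or_false,
    exists_eq_right]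
  constructor
  · rintro (⟨e, he, rfl⟩ | h) <;> omega
  · intro h
    rcases Nat.mod_two_eq_zero_or_one j with h2 | h2
    · exact Or.inl ⟨j, by omega, rfl⟩
    · exact Or.inr (by omega)

theorem inr_mem_laundryList {n k : ℕ} {w : List Letter} (hw : ∀ l ∈ w, IsBraidLetter n l) :
    Sum.inr k ∈ laundryList n w ↔ k < w.length := by
  simp only [laundryList, List.mem_append, List.mem_flatMap, List.mem_map, List.mem_reverse,
    List.mem_filter, List.mem_range, Bool.and_eq_true, beq_iff_eq, bne_iff_ne, List.mem_cons,
    mem_bandBlock, Sum.inr.injEq, reduceCtorEq, and_false, exists_false, false_or, or_false]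
  constructor
  · rintro ⟨e, -, l, hl, -, rfl⟩
    exact hl
  · intro h
    have hc : 1 ≤ colOf w k ∧ colOf w k ≤ n - 1 := by
      rw [colOf, List.getD_eq_getElem _ _ h]
      exact hw _ (List.getElem_mem h)
    refine ⟨colOf w k + colOf w k % 2, by omega, k, h, by omega, rfl⟩

/-- A list enumerating the range of an injective family is a reindexing of that family. -/
theorem List.Nodup.exists_equiv_getD {α ι : Type*} [Fintype ι] {L : List α} (hL : L.Nodup) (d : α)
    {f : ι → α} (hf : Function.Injective f) (hmem : ∀ x, x ∈ L ↔ x ∈ Set.range f) {N : ℕ}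
    (hN : Fintype.card ι = N) : ∃ e : Fin N ≃ ι, ∀ p : Fin N, L.getD p d = f (e p) := by
  classical
  have hlen : L.length = N := by
    rw [← List.toFinset_card_of_nodup hL, ← hN, ← Finset.card_univ,
      ← Finset.card_image_of_injective _ hf]
    congr 1
    ext x
    simp [hmem]
  subst hlen
  let e : Fin L.length ≃ ι := (hL.getEquiv L).trans
    ((Equiv.subtypeEquivRight hmem).trans (Equiv.ofInjective f hf).symm)
  refine ⟨e, fun p => ?_⟩
  have h : f (e p) = ((Equiv.ofInjective f hf) (e p) : α) := rfl
  rw [h]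
  simp [e]

/-- The circle cycles, the band cycle of a distinguished letter, and the band cycles of the
`m` other letters. -/
abbrev MarkedCyc (n m : ℕ) : Type := Fin n ⊕ Option (Fin m)

/-- The cycles of a word of length `m + 1` with its first letter distinguished. -/
def firstMarked {n m : ℕ} : MarkedCyc n m → Cyc
  | Sum.inl j => Sum.inl (j + 1)
  | Sum.inr none => Sum.inr 0
  | Sum.inr (some k) => Sum.inr (k + 1)

/-- The cycles of a word of length `m + 1` with its last letter distinguished. -/
def lastMarked {n m : ℕ} : MarkedCyc n m → Cyc
  | Sum.inl j => Sum.inl (j + 1)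
  | Sum.inr none => Sum.inr m
  | Sum.inr (some k) => Sum.inr k

theorem firstMarked_injective {n m : ℕ} : Function.Injective (@firstMarked n m) := by
  rintro (a | _ | a) (b | _ | b) h <;> simp_all [firstMarked, Fin.ext_iff]

theorem lastMarked_injective {n m : ℕ} : Function.Injective (@lastMarked n m) := by
  rintro (a | _ | a) (b | _ | b) h <;> simp_all [lastMarked, Fin.ext_iff] <;> omega

theorem inl_mem_range_firstMarked {n m j : ℕ} :
    Sum.inl j ∈ Set.range (@firstMarked n m) ↔ 1 ≤ j ∧ j ≤ n := by
  constructor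
  · rintro ⟨a | _ | a, h⟩ <;> cases h
    omega
  · intro h
    exact ⟨Sum.inl ⟨j - 1, by omega⟩, congrArg Sum.inl (by dsimp only; omega)⟩

theorem inl_mem_range_lastMarked {n m j : ℕ} :
    Sum.inl j ∈ Set.range (@lastMarked n m) ↔ 1 ≤ j ∧ j ≤ n := by
  constructor
  · rintro ⟨a | _ | a, h⟩ <;> cases h
    omega
  · intro h
    exact ⟨Sum.inl ⟨j - 1, by omega⟩, congrArg Sum.inl (by dsimp only; omega)⟩

theorem inr_mem_range_firstMarked {n m k : ℕ} :
    Sum.inr k ∈ Set.range (@firstMarked n m) ↔ k < m + 1 := by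
  constructor
  · rintro ⟨a | _ | a, h⟩ <;> cases h <;> omega
  · intro h
    cases k with
    | zero => exact ⟨Sum.inr none, rfl⟩
    | succ k => exact ⟨Sum.inr (some ⟨k, by omega⟩), rfl⟩

theorem inr_mem_range_lastMarked {n m k : ℕ} :
    Sum.inr k ∈ Set.range (@lastMarked n m) ↔ k < m + 1 := by
  constructor
  · rintro ⟨a | _ | a, h⟩ <;> cases h <;> omega
  · intro h
    rcases Nat.lt_succ_iff_lt_or_eq.1 h with h | rfl
    · exact ⟨Sum.inr (some ⟨k, h⟩), rfl⟩
    · exact ⟨Sum.inr none, rfl⟩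

/-- The linking matrix is the matrix of linking numbers in any enumeration of the cycles,
reindexed. -/
theorem exists_linkMat_eq_submatrix {n m : ℕ} {w : List Letter} {f : MarkedCyc n m → Cyc}
    (hw : ∀ l ∈ w, IsBraidLetter n l) (hlen : w.length = m + 1) (hf : Function.Injective f)
    (hinl : ∀ j, Sum.inl j ∈ Set.range f ↔ 1 ≤ j ∧ j ≤ n)
    (hinr : ∀ k, Sum.inr k ∈ Set.range f ↔ k < m + 1) :
    ∃ e : Fin (n + (m + 1)) ≃ MarkedCyc n m,
      linkMat n (m + 1) w = (Matrix.of fun x y => entry w (f x) (f y)).submatrix e e := by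
  obtain ⟨e, he⟩ := (nodup_laundryList n w).exists_equiv_getD (Sum.inl 0) hf
    (by
      rintro (j | k)
      · rw [inl_mem_laundryList, hinl]
      · rw [inr_mem_laundryList hw, hinr, hlen])
    (N := n + (m + 1)) (by simp)
  refine ⟨e, ?_⟩
  ext p q
  simp only [linkMat, Matrix.submatrix_apply, Matrix.of_apply, he]

/-- Congruence by a transvection-like rank one update of the identity. -/
theorem Matrix.congr_one_add_vecMulVec_apply {ι R : Type*} [Fintype ι] [DecidableEq ι] [CommRing R]
    (N : Matrix ι ι R) (u v : ι → R) (x y : ι) :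
    ((1 + vecMulVec u v)ᵀ * N * (1 + vecMulVec u v) : Matrix ι ι R) x y =
      N x y + v x * (u ᵥ* N) y + (N *ᵥ u) x * v y + v x * (u ⬝ᵥ N *ᵥ u) * v y := by
  rw [Matrix.transpose_add, Matrix.transpose_one, Matrix.transpose_vecMulVec, Matrix.add_mul,
    Matrix.mul_add, Matrix.one_mul, Matrix.mul_one, Matrix.vecMulVec_mul, Matrix.mul_vecMulVec,
    Matrix.add_mulVec, Matrix.vecMulVec_mulVec]
  simp only [Matrix.add_apply, Matrix.vecMulVec_apply, Pi.add_apply, Pi.smul_apply,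
    MulOpposite.smul_eq_mul_unop, MulOpposite.unop_op, Matrix.dotProduct_mulVec]
  ring

theorem colOf_cons_zero (l : Letter) (w : List Letter) : colOf (l :: w) 0 = l.1 := rfl

theorem colOf_cons_succ (l : Letter) (w : List Letter) (k : ℕ) :
    colOf (l :: w) (k + 1) = colOf w k := by simp [colOf]

theorem signOf_cons_zero (l : Letter) (w : List Letter) : signOf (l :: w) 0 = l.2 := rfl

theorem signOf_cons_succ (l : Letter) (w : List Letter) (k : ℕ) :
    signOf (l :: w) (k + 1) = signOf w k := by simp [signOf]

theorem colOf_append_length (l : Letter) (w : List Letter) :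
    colOf (w ++ [l]) w.length = l.1 := by simp [colOf]

theorem colOf_append_of_lt (l : Letter) (w : List Letter) (k : Fin w.length) :
    colOf (w ++ [l]) k = colOf w k := by simp [colOf]

theorem signOf_append_length (l : Letter) (w : List Letter) :
    signOf (w ++ [l]) w.length = l.2 := by simp [signOf]

theorem signOf_append_of_lt (l : Letter) (w : List Letter) (k : Fin w.length) :
    signOf (w ++ [l]) k = signOf w k := by simp [signOf]

/-- The linking matrix of `l :: w` in the enumeration with the letter `l` distinguished. -/
def consMat (n : ℕ) (l : Letter) (w : List Letter) :
    Matrix (MarkedCyc n w.length) (MarkedCyc n w.length) ℤ :=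
  Matrix.of fun x y => entry (l :: w) (firstMarked x) (firstMarked y)

/-- The linking matrix of `w ++ [l]` in the enumeration with the letter `l` distinguished. -/
def snocMat (n : ℕ) (l : Letter) (w : List Letter) :
    Matrix (MarkedCyc n w.length) (MarkedCyc n w.length) ℤ :=
  Matrix.of fun x y => entry (w ++ [l]) (lastMarked x) (lastMarked y)

/-- Moving the letter `(i + 1, ε)` from the end of a word to its beginning replaces its band cycle
`X` by `X - C_{i+1} - C_{i+2}`. -/
theorem exists_consMat_eq_congr_snocMat {n i : ℕ} (hi : i + 1 < n) (ε : ℤ) (w : List Letter) :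
    ∃ T : Matrix (MarkedCyc n w.length) (MarkedCyc n w.length) ℤ,
      IsUnit T ∧ consMat n (i + 1, ε) w = Tᵀ * snocMat n (i + 1, ε) w * T := by
  let a : MarkedCyc n w.length := Sum.inl ⟨i, by omega⟩
  let b : MarkedCyc n w.length := Sum.inl ⟨i + 1, hi⟩
  let u : MarkedCyc n w.length → ℤ := -(Pi.single a 1 + Pi.single b 1)
  let v : MarkedCyc n w.length → ℤ := Pi.single (Sum.inr none) 1
  have hvu : v ⬝ᵥ u = 0 := by simp [v, u, a, b]
  refine ⟨1 + vecMulVec u v, ?_, ?_⟩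
  · rw [Matrix.isUnit_iff_isUnit_det, Matrix.vecMulVec_eq Unit,
      Matrix.det_one_add_replicateCol_mul_replicateRow, hvu]
    simp
  · ext x y
    rw [Matrix.congr_one_add_vecMulVec_apply]
    have huN (z) : (u ᵥ* snocMat n (i + 1, ε) w) z =
        -(snocMat n (i + 1, ε) w a z + snocMat n (i + 1, ε) w b z) := by
      simp [u, Matrix.neg_vecMul, Matrix.add_vecMul]
    have hNu (z) : (snocMat n (i + 1, ε) w *ᵥ u) z =
        -(snocMat n (i + 1, ε) w z a + snocMat n (i + 1, ε) w z b) := by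
      simp [u, Matrix.mulVec_neg, Matrix.mulVec_add]
    have huNu : u ⬝ᵥ snocMat n (i + 1, ε) w *ᵥ u = 0 := by
      have hu (z : MarkedCyc n w.length → ℤ) : u ⬝ᵥ z = -(z a + z b) := by
        simp [u, neg_dotProduct, add_dotProduct]
      rw [hu, hNu, hNu]
      simp [a, b, snocMat, lastMarked, entry]
    rw [huN, hNu, huNu]
    rcases x with x | _ | x <;> rcases y with y | _ | y <;>
      simp [a, b, v, consMat, snocMat, firstMarked, lastMarked, entry, colOf_cons_zero,
        colOf_cons_succ, signOf_cons_zero, signOf_cons_succ, colOf_append_length,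
        colOf_append_of_lt, signOf_append_length, signOf_append_of_lt] <;> grind

/-- **conjugation move M3.** The linking matrices of `(i,ε) · w` and
`w · (i,ε)` are unimodular-congruent. -/
theorem linkMat_conjugation_unimodular_congruent (n : ℕ) (w : List Letter)
    (hw : IsBraidWord n w) (i : ℕ) (hi : 1 ≤ i ∧ i ≤ n - 1) (ε : ℤ)
    (hε : ε = 1 ∨ ε = -1) :
    ∃ P : Matrix (Fin (n + (w.length + 1))) (Fin (n + (w.length + 1))) ℤ,
      (P.det = 1 ∨ P.det = -1) ∧
      linkMat n (w.length + 1) ((i, ε) :: w) =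
        Pᵀ * linkMat n (w.length + 1) (w ++ [(i, ε)]) * P := by
  obtain ⟨-, -, hw⟩ := hw
  obtain ⟨i, rfl⟩ : ∃ j, i = j + 1 := ⟨i - 1, by omega⟩
  have hw' : ∀ l ∈ (i + 1, ε) :: w, IsBraidLetter n l := by
    intro l hl
    rcases List.mem_cons.1 hl with rfl | hl
    · exact hi
    · exact ⟨(hw l hl).1, (hw l hl).2.1⟩
  obtain ⟨e, he⟩ := exists_linkMat_eq_submatrix (m := w.length) hw' (by simp) firstMarked_injective
    (fun _ => inl_mem_range_firstMarked) (fun _ => inr_mem_range_firstMarked)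
  obtain ⟨e', he'⟩ := exists_linkMat_eq_submatrix (m := w.length) (w := w ++ [(i + 1, ε)])
    (fun l hl => hw' l (by simpa [or_comm] using hl)) (by simp) lastMarked_injective
    (fun _ => inl_mem_range_lastMarked) (fun _ => inr_mem_range_lastMarked)
  obtain ⟨T, hT, hcongr⟩ := exists_consMat_eq_congr_snocMat (n := n) (i := i) (by omega) ε w
  refine ⟨T.submatrix e' e, ?_, ?_⟩
  · rw [← Int.isUnit_iff, ← Matrix.isUnit_iff_isUnit_det, Matrix.isUnit_submatrix_equiv]
    exact hT
  · change _ = (consMat n (i + 1, ε) w).submatrix e e at he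
    change _ = (snocMat n (i + 1, ε) w).submatrix e' e' at he'
    rw [he, he', hcongr, Matrix.transpose_submatrix, Matrix.submatrix_mul_equiv,
      Matrix.submatrix_mul_equiv]
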